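/- arXiv:1907.11506 — 4 statements merged into one kernel-verified Lean document; each statement's English description precedes it below -/
import Mathlib

section
/- Let F be a field and let A and B be unital locally matrix F-algebras. Then the tensor product A ⊗_F B is a unital locally matrix F-algebra, and D(A ⊗_F B) = { d : there exist m ∈ D(A) and k ∈ D(B) with d ∣ m·k }. -/
/-- `D(A)`: the set of positive integers `n` such that `A` contains a unital subalgebra
isomorphic to the `n × n` matrix algebra over `F`. -/
def matrixDegreeSet (F : Type*) [Field F] (A : Type*) [Ring A] [Algebra F A] : Set ℕ :=
  {n | 0 < n ∧ ∃ S : Subalgebra F A, Nonempty (S ≃ₐ[F] Matrix (Fin n) (Fin n) F)}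

/-- A unital `F`-algebra is a locally matrix algebra if every finite subset lies in a
unital subalgebra isomorphic to a matrix algebra `M_n(F)`, `n ≥ 1`. -/
def IsLocallyMatrixAlgebra (F : Type*) [Field F] (A : Type*) [Ring A] [Algebra F A] : Prop :=
  ∀ s : Finset A, ∃ (n : ℕ) (S : Subalgebra F A), 0 < n ∧ (s : Set A) ⊆ S ∧
    Nonempty (S ≃ₐ[F] Matrix (Fin n) (Fin n) F)

open scoped TensorProduct

/-- If `M_d(F)` maps unitally to the endomorphisms of a finite-dimensional space `V`, then `d`
divides the dimension of `V`. -/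
theorem dvd_finrank_of_matrix_algHom {F : Type*} [Field F] {V : Type*} [AddCommGroup V]
    [Module F V] [FiniteDimensional F V] {d : ℕ} (hd : 0 < d)
    (f : Matrix (Fin d) (Fin d) F →ₐ[F] Module.End F V) : d ∣ Module.finrank F V := by
  classical
  let z : Fin d := ⟨0, hd⟩
  let e (i j : Fin d) : Module.End F V := f (Matrix.single i j 1)
  have hmul (i j k : Fin d) (v : V) : e i j (e j k v) = e i k v := by
    simp only [e, ← Module.End.mul_apply, ← map_mul, Matrix.single_mul_single_same, mul_one]
  have hzero (i j k l : Fin d) (h : j ≠ k) (v : V) : e i j (e k l v) = 0 := by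
    simp only [e, ← Module.End.mul_apply, ← map_mul]
    rw [Matrix.single_mul_single_of_ne _ _ _ _ h]
    simp
  have hsum (v : V) : ∑ i, e i i v = v := by
    simp only [e, ← LinearMap.sum_apply, ← map_sum, Matrix.sum_single_one, map_one,
      Module.End.one_apply]
  let W : Submodule F V := LinearMap.range (e z z)
  have hW (w : W) : e z z w = w := by
    obtain ⟨_, v, rfl⟩ := w
    exact hmul z z z v
  let φ : V ≃ₗ[F] (Fin d → W) :=
    { toFun := fun v j => ⟨e z j v, e z j v, hmul z z j v⟩
      map_add' := fun v w => by ext; simp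
      map_smul' := fun c v => by ext; simp
      invFun := fun w => ∑ j, e j z (w j)
      left_inv := fun v => by simp only [hmul, hsum]
      right_inv := fun w => by
        ext i
        simp only [map_sum]
        rw [Finset.sum_eq_single i (fun j _ hj => hzero _ _ _ _ hj.symm _) (by simp), hmul, hW] }
  rw [φ.finrank_eq, Module.finrank_pi_fintype]
  simp

/-- A unital embedding `M_d(F) → M_n(F)` forces `d ∣ n`. -/
theorem dvd_of_matrix_algHom {F : Type*} [Field F] {d n : ℕ} (hd : 0 < d)
    (f : Matrix (Fin d) (Fin d) F →ₐ[F] Matrix (Fin n) (Fin n) F) : d ∣ n := by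
  simpa using dvd_finrank_of_matrix_algHom hd
    ((Matrix.toLinAlgEquiv' (R := F) (n := Fin n)).toAlgHom.comp f)

/-- The Kronecker product isomorphism `M_m(F) ⊗ M_k(F) ≃ M_{mk}(F)` on `Fin`-indexed matrices. -/
noncomputable def kroneckerFinAlgEquiv (F : Type*) [Field F] (m k : ℕ) :
    Matrix (Fin m) (Fin m) F ⊗[F] Matrix (Fin k) (Fin k) F ≃ₐ[F]
      Matrix (Fin (m * k)) (Fin (m * k)) F :=
  (Matrix.kroneckerAlgEquiv (Fin m) (Fin k) F).trans
    (Matrix.reindexAlgEquiv F F finProdFinEquiv)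

theorem exists_injective_matrix_algHom_of_dvd (F : Type*) [Field F] {d n : ℕ} (hn : 0 < n)
    (h : d ∣ n) :
    ∃ f : Matrix (Fin d) (Fin d) F →ₐ[F] Matrix (Fin n) (Fin n) F, Function.Injective f := by
  obtain ⟨e, rfl⟩ := h
  have : NeZero d := ⟨by rintro rfl; simp at hn⟩
  have : NeZero (d * e) := ⟨hn.ne'⟩
  exact ⟨(kroneckerFinAlgEquiv F d e).toAlgHom.comp Algebra.TensorProduct.includeLeft,
    ((kroneckerFinAlgEquiv F d e).toAlgHom.comp
      Algebra.TensorProduct.includeLeft).toRingHom.injective⟩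

theorem exists_subalgebra_algEquiv_iff {F : Type*} [Field F] {A M : Type*} [Ring A] [Algebra F A]
    [Ring M] [Algebra F M] (s : Set A) :
    (∃ S : Subalgebra F A, s ⊆ S ∧ Nonempty (S ≃ₐ[F] M)) ↔
      ∃ f : M →ₐ[F] A, Function.Injective f ∧ s ⊆ f.range := by
  constructor
  · rintro ⟨S, hs, ⟨φ⟩⟩
    exact ⟨S.val.comp φ.symm.toAlgHom, Subtype.val_injective.comp φ.symm.injective,
      fun x hx => ⟨φ ⟨x, hs hx⟩, by simp⟩⟩
  · rintro ⟨f, hf, hs⟩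
    exact ⟨f.range, hs, ⟨(AlgEquiv.ofInjective f hf).symm⟩⟩

theorem mem_matrixDegreeSet_iff {F : Type*} [Field F] {A : Type*} [Ring A] [Algebra F A] {n : ℕ} :
    n ∈ matrixDegreeSet F A ↔
      0 < n ∧ ∃ f : Matrix (Fin n) (Fin n) F →ₐ[F] A, Function.Injective f := by
  simpa [matrixDegreeSet] using fun _ =>
    exists_subalgebra_algEquiv_iff (F := F) (M := Matrix (Fin n) (Fin n) F) (∅ : Set A)

theorem isLocallyMatrixAlgebra_iff {F : Type*} [Field F] {A : Type*} [Ring A] [Algebra F A] :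
    IsLocallyMatrixAlgebra F A ↔ ∀ s : Finset A, ∃ n : ℕ, 0 < n ∧
      ∃ f : Matrix (Fin n) (Fin n) F →ₐ[F] A, Function.Injective f ∧ (s : Set A) ⊆ f.range := by
  simp only [IsLocallyMatrixAlgebra, ← exists_subalgebra_algEquiv_iff, exists_and_left]

/-- Embeddings of `M_m(F)` in `A` and of `M_k(F)` in `B` give one of `M_{mk}(F)` in `A ⊗ B`. -/
theorem exists_matrix_algHom_tensorProduct {F : Type*} [Field F] {A B : Type*} [Ring A]
    [Algebra F A] [Ring B] [Algebra F B] {m k : ℕ} (f : Matrix (Fin m) (Fin m) F →ₐ[F] A)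
    (g : Matrix (Fin k) (Fin k) F →ₐ[F] B) (hf : Function.Injective f)
    (hg : Function.Injective g) :
    ∃ h : Matrix (Fin (m * k)) (Fin (m * k)) F →ₐ[F] A ⊗[F] B, Function.Injective h ∧
      h.range = (Algebra.TensorProduct.map f g).range := by
  let φ := kroneckerFinAlgEquiv F m k
  refine ⟨(Algebra.TensorProduct.map f g).comp φ.symm.toAlgHom, ?_, ?_⟩
  · exact (TensorProduct.map_injective_of_flat_flat f.toLinearMap g.toLinearMap hf hg).comp
      φ.symm.injective
  · ext x
    exact φ.symm.surjective.exists (p := fun y => Algebra.TensorProduct.map f g y = x) |>.symm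

/-- Finitely many elements of `A ⊗ B` only involve finitely many elements of `A` and of `B`. -/
theorem exists_finset_subset_range_map {F : Type*} [Field F] {A B : Type*} [Ring A]
    [Algebra F A] [Ring B] [Algebra F B] (s : Finset (A ⊗[F] B)) :
    ∃ (a : Finset A) (b : Finset B), ∀ {M N : Type*} [Ring M] [Algebra F M] [Ring N] [Algebra F N]
      (f : M →ₐ[F] A) (g : N →ₐ[F] B), (a : Set A) ⊆ f.range → (b : Set B) ⊆ g.range →
      (s : Set (A ⊗[F] B)) ⊆ (Algebra.TensorProduct.map f g).range := by
  classical
  have key (x : A ⊗[F] B) : ∃ (a : Finset A) (b : Finset B),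
      ∀ {M N : Type _} [Ring M] [Algebra F M] [Ring N] [Algebra F N]
      (f : M →ₐ[F] A) (g : N →ₐ[F] B), (a : Set A) ⊆ f.range → (b : Set B) ⊆ g.range →
      x ∈ (Algebra.TensorProduct.map f g).range := by
    induction x with
    | zero => exact ⟨∅, ∅, fun _ _ _ _ => zero_mem _⟩
    | tmul x y =>
      refine ⟨{x}, {y}, fun f g hf hg => ?_⟩
      obtain ⟨u, hu⟩ := hf (by simp : x ∈ _)
      obtain ⟨v, hv⟩ := hg (by simp : y ∈ _)
      exact ⟨u ⊗ₜ v, by simpa using congr_arg₂ (· ⊗ₜ[F] ·) hu hv⟩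
    | add x y hx hy =>
      obtain ⟨a, b, h⟩ := hx
      obtain ⟨a', b', h'⟩ := hy
      refine ⟨a ∪ a', b ∪ b', fun f g hf hg => ?_⟩
      rw [Finset.coe_union, Set.union_subset_iff] at hf hg
      exact add_mem (h f g hf.1 hg.1) (h' f g hf.2 hg.2)
  choose a b h using key
  refine ⟨s.biUnion a, s.biUnion b, fun f g hf hg x hx => h x f g ?_ ?_⟩
  · exact (Finset.coe_subset.2 (Finset.subset_biUnion_of_mem a hx)).trans hf
  · exact (Finset.coe_subset.2 (Finset.subset_biUnion_of_mem b hx)).trans hg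

/-- Given `M_d(F) → C`, there is a finite set `s` (the image of a basis) such that any embedded
matrix algebra `M_n(F)` in `C` containing `s` satisfies `d ∣ n`. -/
theorem exists_finset_forall_dvd {F : Type*} [Field F] {C : Type*} [Ring C] [Algebra F C] {d : ℕ}
    (hd : 0 < d) (f : Matrix (Fin d) (Fin d) F →ₐ[F] C) :
    ∃ s : Finset C, ∀ {n : ℕ} (g : Matrix (Fin n) (Fin n) F →ₐ[F] C), Function.Injective g →
      (s : Set C) ⊆ g.range → d ∣ n := by
  classical
  let b := Module.finBasis F (Matrix (Fin d) (Fin d) F)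
  refine ⟨Finset.univ.image (f ∘ b), fun {n} g hg hs => ?_⟩
  have hfg (x) : f x ∈ g.range := by
    have : LinearMap.range f.toLinearMap ≤ Subalgebra.toSubmodule g.range := by
      rw [LinearMap.range_eq_map, ← b.span_eq, Submodule.map_span, Submodule.span_le]
      rintro _ ⟨_, ⟨i, rfl⟩, rfl⟩
      exact hs (by simp)
    exact this ⟨x, rfl⟩
  exact dvd_of_matrix_algHom hd
    ((AlgEquiv.ofInjective g hg).symm.toAlgHom.comp (f.codRestrict g.range hfg))

/-- Every finite subset of `A ⊗ B` lies in a matrix algebra whose degree is a product of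
elements of `D(A)` and `D(B)`. -/
theorem exists_matrix_algHom_of_finset {F : Type*} [Field F] {A B : Type*} [Ring A] [Algebra F A]
    [Ring B] [Algebra F B] (hA : IsLocallyMatrixAlgebra F A) (hB : IsLocallyMatrixAlgebra F B)
    (s : Finset (A ⊗[F] B)) :
    ∃ m ∈ matrixDegreeSet F A, ∃ k ∈ matrixDegreeSet F B,
      ∃ h : Matrix (Fin (m * k)) (Fin (m * k)) F →ₐ[F] A ⊗[F] B, Function.Injective h ∧
        (s : Set (A ⊗[F] B)) ⊆ h.range := by
  obtain ⟨a, b, hab⟩ := exists_finset_subset_range_map s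
  obtain ⟨m, hm, f, hf, haf⟩ := isLocallyMatrixAlgebra_iff.1 hA a
  obtain ⟨k, hk, g, hg, hbg⟩ := isLocallyMatrixAlgebra_iff.1 hB b
  obtain ⟨h, hh, hr⟩ := exists_matrix_algHom_tensorProduct f g hf hg
  exact ⟨m, mem_matrixDegreeSet_iff.2 ⟨hm, f, hf⟩, k, mem_matrixDegreeSet_iff.2 ⟨hk, g, hg⟩,
    h, hh, hr ▸ hab f g haf hbg⟩

theorem stmt_1 (F : Type*) [Field F] (A B : Type*) [Ring A] [Algebra F A]
    [Ring B] [Algebra F B]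
    (hA : IsLocallyMatrixAlgebra F A) (hB : IsLocallyMatrixAlgebra F B) :
    IsLocallyMatrixAlgebra F (TensorProduct F A B) ∧
      matrixDegreeSet F (TensorProduct F A B) =
        {d | ∃ m ∈ matrixDegreeSet F A, ∃ k ∈ matrixDegreeSet F B, d ∣ m * k} := by
  refine ⟨isLocallyMatrixAlgebra_iff.2 fun s => ?_, Set.ext fun d => ⟨fun hd => ?_, ?_⟩⟩
  · obtain ⟨m, hm, k, hk, h, hh⟩ := exists_matrix_algHom_of_finset hA hB s
    exact ⟨m * k, Nat.mul_pos hm.1 hk.1, h, hh⟩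
  · obtain ⟨hd, f, -⟩ := mem_matrixDegreeSet_iff.1 hd
    obtain ⟨s, hs⟩ := exists_finset_forall_dvd hd f
    obtain ⟨m, hm, k, hk, h, hh, hsh⟩ := exists_matrix_algHom_of_finset hA hB s
    exact ⟨m, hm, k, hk, hs h hh hsh⟩
  · rintro ⟨m, hm, k, hk, hdvd⟩
    obtain ⟨hm, f, hf⟩ := mem_matrixDegreeSet_iff.1 hm
    obtain ⟨hk, g, hg⟩ := mem_matrixDegreeSet_iff.1 hk
    obtain ⟨h, hh, -⟩ := exists_matrix_algHom_tensorProduct f g hf hg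
    have hmk := Nat.mul_pos hm hk
    obtain ⟨i, hi⟩ := exists_injective_matrix_algHom_of_dvd F hmk hdvd
    exact mem_matrixDegreeSet_iff.2 ⟨Nat.pos_of_dvd_of_pos hdvd hmk, h.comp i, hh.comp hi⟩
end

section
/- Let F be an algebraically closed field with char F ≠ 2, let V be an F-vector space of finite even dimension n, and let Q be a nondegenerate quadratic form on V (its polar bilinear form (u,v) ↦ Q(u+v) − Q(u) − Q(v) is nondegenerate). Then the Clifford algebra Cl(V,Q) is isomorphic as an F-algebra to the matrix algebra M_{2^{n/2}}(F). -/
open QuadraticMap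

universe u

namespace CliffordAlgebra

section HyperbolicPlane

variable (R : Type*) [CommRing R]

/-- The hyperbolic plane: the quadratic form `(a, b) ↦ a * b` on `R × R`. -/
def hyperbolicPlane : QuadraticForm R (R × R) :=
  linMulLin (LinearMap.fst R R R) (LinearMap.snd R R R)

variable {R}

@[simp]
theorem hyperbolicPlane_apply (p : R × R) : hyperbolicPlane R p = p.1 * p.2 := rfl

variable {M : Type*} [AddCommGroup M] [Module R M] (Q : QuadraticForm R M)

/-- The linear map underlying `prodHyperbolicToMatrix`. -/
def prodHyperbolicToMatrixAux :
    M × (R × R) →ₗ[R] Matrix (Fin 2) (Fin 2) (CliffordAlgebra Q) where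
  toFun w := !![ι Q w.1, algebraMap R _ w.2.1; algebraMap R _ w.2.2, -ι Q w.1]
  map_add' x y := by
    ext i j; fin_cases i <;> fin_cases j <;> simp [add_comm]
  map_smul' c x := by
    ext i j; fin_cases i <;> fin_cases j <;> simp [Algebra.smul_def]

/-- The Clifford algebra of the orthogonal sum of `Q` and a hyperbolic plane acts by
`2 × 2` matrices over the Clifford algebra of `Q`. -/
def prodHyperbolicToMatrix :
    CliffordAlgebra (Q.prod (hyperbolicPlane R)) →ₐ[R]
      Matrix (Fin 2) (Fin 2) (CliffordAlgebra Q) :=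
  lift _ ⟨prodHyperbolicToMatrixAux Q, fun w => by
    ext i j
    fin_cases i <;> fin_cases j <;>
      simp [prodHyperbolicToMatrixAux, Matrix.mul_apply, Matrix.algebraMap_matrix_apply,
        Algebra.commutes w.2.1 (ι Q w.1), Algebra.commutes w.2.2 (ι Q w.1),
        Algebra.commutes w.2.2 (algebraMap R (CliffordAlgebra Q) w.2.1), add_comm]⟩

theorem prodHyperbolicToMatrix_ι (w : M × (R × R)) :
    prodHyperbolicToMatrix Q (ι _ w) =
      !![ι Q w.1, algebraMap R _ w.2.1; algebraMap R _ w.2.2, -ι Q w.1] :=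
  lift_ι_apply _ _ _

theorem prodHyperbolicToMatrix_map_inl (x : CliffordAlgebra Q) :
    prodHyperbolicToMatrix Q (map (QuadraticMap.Isometry.inl Q (hyperbolicPlane R)) x) =
      !![x, 0; 0, involute x] := by
  induction x using CliffordAlgebra.induction with
  | algebraMap r =>
    ext i j
    fin_cases i <;> fin_cases j <;> simp [Matrix.algebraMap_matrix_apply]
  | ι v => simp [prodHyperbolicToMatrix_ι]
  | mul a b ha hb => simp [ha, hb]
  | add a b ha hb => simp [ha, hb]

theorem ι_inr_mul_map_inl {M' : Type*} [AddCommGroup M'] [Module R M'] (Q' : QuadraticForm R M')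
    (p : M') (x : CliffordAlgebra Q) :
    ι (Q.prod Q') (0, p) * map (QuadraticMap.Isometry.inl Q Q') x =
      map (QuadraticMap.Isometry.inl Q Q') (involute x) * ι (Q.prod Q') (0, p) := by
  induction x using CliffordAlgebra.induction with
  | algebraMap r => simp [Algebra.commutes]
  | ι v =>
    have h : (Q.prod Q').IsOrtho ((0 : M), p) (v, (0 : M')) := QuadraticMap.IsOrtho.inr_inl v p
    simpa using ι_mul_ι_comm_of_isOrtho h
  | mul a b ha hb => simp only [map_mul, ← mul_assoc, ha]; simp only [mul_assoc, hb]
  | add a b ha hb => simp only [map_add, mul_add, add_mul, ha, hb]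

theorem ι_mul_ι_add_swap_hyperbolicPlane :
    ι (Q.prod (hyperbolicPlane R)) (0, (1, 0)) * ι (Q.prod (hyperbolicPlane R)) (0, (0, 1))
      + ι (Q.prod (hyperbolicPlane R)) (0, (0, 1)) * ι (Q.prod (hyperbolicPlane R)) (0, (1, 0))
        = 1 := by
  simp [ι_mul_ι_add_swap, polar]

/-- The linear inverse of `prodHyperbolicToMatrix`. -/
def matrixToProdHyperbolic (X : Matrix (Fin 2) (Fin 2) (CliffordAlgebra Q)) :
    CliffordAlgebra (Q.prod (hyperbolicPlane R)) :=
  let ψ := map (QuadraticMap.Isometry.inl Q (hyperbolicPlane R))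
  let e := ι (Q.prod (hyperbolicPlane R)) (0, (1, 0))
  let f := ι (Q.prod (hyperbolicPlane R)) (0, (0, 1))
  ψ (X 0 0) * (e * f) + ψ (X 0 1) * e + ψ (involute (X 1 0)) * f
    + ψ (involute (X 1 1)) * (f * e)

theorem matrixToProdHyperbolic_add (X Y : Matrix (Fin 2) (Fin 2) (CliffordAlgebra Q)) :
    matrixToProdHyperbolic Q (X + Y) =
      matrixToProdHyperbolic Q X + matrixToProdHyperbolic Q Y := by
  simp only [matrixToProdHyperbolic, Matrix.add_apply, map_add, add_mul]
  abel

theorem matrixToProdHyperbolic_smul (r : R) (X : Matrix (Fin 2) (Fin 2) (CliffordAlgebra Q)) :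
    matrixToProdHyperbolic Q (r • X) = r • matrixToProdHyperbolic Q X := by
  simp only [matrixToProdHyperbolic, Matrix.smul_apply, map_smul, smul_mul_assoc, smul_add]

theorem matrixToProdHyperbolic_ι_mul (w : M × (R × R))
    (X : Matrix (Fin 2) (Fin 2) (CliffordAlgebra Q)) :
    matrixToProdHyperbolic Q (prodHyperbolicToMatrix Q (ι _ w) * X) =
      ι _ w * matrixToProdHyperbolic Q X := by
  have hw : ι (Q.prod (hyperbolicPlane R)) w =
      map (QuadraticMap.Isometry.inl Q (hyperbolicPlane R)) (ι Q w.1)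
        + w.2.1 • ι (Q.prod (hyperbolicPlane R)) (0, (1, 0))
        + w.2.2 • ι (Q.prod (hyperbolicPlane R)) (0, (0, 1)) := by
    rw [map_apply_ι, ← map_smul, ← map_smul, ← map_add, ← map_add]
    congr 1
    ext <;> simp
  have he (x) := ι_inr_mul_map_inl Q (hyperbolicPlane R) (1, 0) x
  have hf (x) := ι_inr_mul_map_inl Q (hyperbolicPlane R) (0, 1) x
  have hee := ι_sq_scalar (Q.prod (hyperbolicPlane R)) (0, (1, 0))
  have hff := ι_sq_scalar (Q.prod (hyperbolicPlane R)) (0, (0, 1))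
  have hef := ι_mul_ι_add_swap_hyperbolicPlane Q
  simp only [prod_apply, hyperbolicPlane_apply, map_zero, mul_zero, zero_mul, add_zero] at hee hff
  rw [prodHyperbolicToMatrix_ι, hw]
  simp only [matrixToProdHyperbolic, Matrix.mul_apply, Fin.sum_univ_two, Matrix.of_apply,
    Matrix.cons_val_zero, Matrix.cons_val_one, ← Algebra.smul_def, map_add, map_smul, map_mul,
    map_neg, involute_ι, neg_neg, neg_mul]
  generalize ι (Q.prod (hyperbolicPlane R)) (0, (1, 0)) = e at *
  generalize ι (Q.prod (hyperbolicPlane R)) (0, (0, 1)) = f at *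
  have hfe : f * e = 1 - e * f := by rw [← hef]; abel
  have hefe : e * (f * e) = e := by rw [hfe, mul_sub, ← mul_assoc, hee]; simp
  have hfef : f * (e * f) = f := by rw [← mul_assoc, hfe, sub_mul, mul_assoc, hff]; simp
  have heef : e * (e * f) = 0 := by rw [← mul_assoc, hee, zero_mul]
  have hffe : f * (f * e) = 0 := by rw [← mul_assoc, hff, zero_mul]
  have he' (x y) : e * (map (QuadraticMap.Isometry.inl Q (hyperbolicPlane R)) x * y) =
      map (QuadraticMap.Isometry.inl Q (hyperbolicPlane R)) (involute x) * (e * y) := by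
    rw [← mul_assoc, he, mul_assoc]
  have hf' (x y) : f * (map (QuadraticMap.Isometry.inl Q (hyperbolicPlane R)) x * y) =
      map (QuadraticMap.Isometry.inl Q (hyperbolicPlane R)) (involute x) * (f * y) := by
    rw [← mul_assoc, hf, mul_assoc]
  simp only [add_mul, mul_add, smul_mul_assoc, he', hf', hefe, hfef, heef, hffe, hee, hff,
    involute_involute, mul_zero, add_zero, mul_assoc, smul_zero]
  abel

theorem matrixToProdHyperbolic_mul (x : CliffordAlgebra (Q.prod (hyperbolicPlane R)))
    (X : Matrix (Fin 2) (Fin 2) (CliffordAlgebra Q)) :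
    matrixToProdHyperbolic Q (prodHyperbolicToMatrix Q x * X) =
      x * matrixToProdHyperbolic Q X := by
  induction x using CliffordAlgebra.induction generalizing X with
  | algebraMap r =>
    rw [AlgHom.commutes, ← Algebra.smul_def, matrixToProdHyperbolic_smul, Algebra.smul_def]
  | ι w => exact matrixToProdHyperbolic_ι_mul Q w X
  | mul a b ha hb => rw [map_mul, mul_assoc, ha, hb, mul_assoc]
  | add a b ha hb => rw [map_add, add_mul, matrixToProdHyperbolic_add, ha, hb, add_mul]

theorem matrixToProdHyperbolic_one : matrixToProdHyperbolic Q 1 = 1 := by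
  simpa [matrixToProdHyperbolic] using ι_mul_ι_add_swap_hyperbolicPlane Q

/-- The Clifford algebra of the orthogonal sum of `Q` and a hyperbolic plane is the algebra of
`2 × 2` matrices over the Clifford algebra of `Q`. -/
noncomputable def prodHyperbolicEquiv :
    CliffordAlgebra (Q.prod (hyperbolicPlane R)) ≃ₐ[R]
      Matrix (Fin 2) (Fin 2) (CliffordAlgebra Q) :=
  AlgEquiv.ofBijective (prodHyperbolicToMatrix Q) <| by
    refine Function.bijective_iff_has_inverse.mpr
      ⟨matrixToProdHyperbolic Q, fun x => ?_, fun X => ?_⟩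
    · simpa [matrixToProdHyperbolic_one] using matrixToProdHyperbolic_mul Q x 1
    · simp only [matrixToProdHyperbolic, map_add, map_mul, prodHyperbolicToMatrix_map_inl,
        prodHyperbolicToMatrix_ι]
      ext i j
      fin_cases i <;> fin_cases j <;> simp

end HyperbolicPlane

theorem separatingLeft_polarBilin_prod_hyperbolicPlane {R M : Type*} [CommRing R]
    [AddCommGroup M] [Module R M] {Q : QuadraticForm R M} (hQ : Q.polarBilin.SeparatingLeft) :
    (Q.prod (hyperbolicPlane R)).polarBilin.SeparatingLeft := by
  rintro ⟨v, a, b⟩ h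
  have hv : v = 0 := hQ v fun y => by simpa [polar] using h (y, 0)
  have ha : a = 0 := by simpa [polar, add_mul, mul_add] using h (0, (0, 1))
  have hb : b = 0 := by simpa [polar, add_mul, mul_add] using h (0, (1, 0))
  simp [hv, ha, hb]

/-- In every even dimension there is a nondegenerate quadratic form with split Clifford algebra. -/
theorem exists_separatingLeft_algEquiv_matrix (F : Type u) [Field F] (m : ℕ) :
    ∃ (W : Type u) (_ : AddCommGroup W) (_ : Module F W) (_ : FiniteDimensional F W)
      (Q : QuadraticForm F W), Module.finrank F W = 2 * m ∧ Q.polarBilin.SeparatingLeft ∧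
      Nonempty (CliffordAlgebra Q ≃ₐ[F] Matrix (Fin (2 ^ m)) (Fin (2 ^ m)) F) := by
  induction m with
  | zero =>
    let ε : (0 : QuadraticForm F PUnit.{u + 1}).IsometryEquiv (0 : QuadraticForm F Unit) :=
      { (0 : PUnit.{u + 1} ≃ₗ[F] Unit) with map_app' := fun _ => rfl }
    refine ⟨PUnit.{u + 1}, inferInstance, inferInstance, inferInstance, 0,
      by simp [Module.finrank_zero_of_subsingleton],
      fun _ _ => rfl, ⟨?_⟩⟩
    exact (equivOfIsometry ε).trans <| CliffordAlgebraRing.equiv.trans <|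
      AlgEquiv.ofBijective (Algebra.ofId F (Matrix (Fin (2 ^ 0)) (Fin (2 ^ 0)) F))
        ⟨RingHom.injective _, fun X => ⟨X 0 0, by
          ext i j
          rw [Fin.fin_one_eq_zero i, Fin.fin_one_eq_zero j]
          simp [Algebra.ofId_apply, Matrix.algebraMap_matrix_apply]⟩⟩
  | succ m ih =>
    obtain ⟨W, _, _, _, Q, hW, hQ, ⟨φ⟩⟩ := ih
    refine ⟨W × (F × F), inferInstance, inferInstance, inferInstance,
      Q.prod (hyperbolicPlane F), ?_, separatingLeft_polarBilin_prod_hyperbolicPlane hQ, ⟨?_⟩⟩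
    · simp [hW, mul_add]
    · exact (prodHyperbolicEquiv Q).trans <| (AlgEquiv.mapMatrix φ).trans <|
        (Matrix.compAlgEquiv (Fin 2) (Fin (2 ^ m)) F F).trans <|
        Matrix.reindexAlgEquiv F F (finProdFinEquiv.trans (finCongr (pow_succ' 2 m).symm))

end CliffordAlgebra

theorem QuadraticMap.separatingLeft_associated {R M : Type*} [CommRing R] [Invertible (2 : R)]
    [AddCommGroup M] [Module R M] {Q : QuadraticForm R M} (hQ : Q.polarBilin.SeparatingLeft) :
    (associated Q).SeparatingLeft := fun x hx =>
  hQ x fun y => by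
    have h := hx y
    rw [← two_nsmul_associated R, LinearMap.smul_apply, LinearMap.smul_apply, h, smul_zero]

theorem stmt_6 (F : Type*) [Field F] [IsAlgClosed F] (hchar : ringChar F ≠ 2)
    (V : Type*) [AddCommGroup V] [Module F V] [FiniteDimensional F V]
    (n : ℕ) (hn : Module.finrank F V = n) (hneven : Even n)
    (Q : QuadraticForm F V)
    (hQ : LinearMap.BilinForm.Nondegenerate (QuadraticMap.polarBilin Q)) :
    Nonempty (CliffordAlgebra Q ≃ₐ[F]
      Matrix (Fin (2 ^ (n / 2))) (Fin (2 ^ (n / 2))) F) := by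
  have := invertibleOfNonzero (Ring.two_ne_zero hchar)
  obtain ⟨W, _, _, _, Q', hW, hQ', ⟨φ⟩⟩ :=
    CliffordAlgebra.exists_separatingLeft_algEquiv_matrix F (n / 2)
  have hdim : Module.finrank F V = Module.finrank F W := by
    rw [hW, hn, Nat.two_mul_div_two_of_even hneven]
  have h₁ := QuadraticForm.equivalent_weightedSumSquares_of_isAlgClosed Q (separatingLeft_associated hQ.1)
  have h₂ := QuadraticForm.equivalent_weightedSumSquares_of_isAlgClosed Q' (separatingLeft_associated hQ')
  rw [hdim] at h₁
  obtain ⟨ε⟩ := h₁.trans h₂.symm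
  exact ⟨(CliffordAlgebra.equivOfIsometry ε).trans φ⟩
end

section
/- Let F be an algebraically closed field with char F ≠ 2, let V be an infinite-dimensional F-vector space, and let Q be a nondegenerate quadratic form on V. Then the Clifford algebra Cl(V,Q) is a unital locally matrix F-algebra, and D(Cl(V,Q)) = { 2^k : k ∈ ℕ } (equivalently, the Steinitz number of Cl(V,Q) is 2^∞). -/
open Algebra Module
open scoped TensorProduct

/-- Two elements with `p² = q² = 0` and `pq + qp = 1` form the off-diagonal part of a system of
`2 × 2` matrix units. -/
lemma exists_matrix_two_algHom {F A : Type*} [Field F] [Ring A] [Algebra F A] {p q : A}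
    (hp : p * p = 0) (hq : q * q = 0) (hpq : p * q + q * p = 1) :
    ∃ f : Matrix (Fin 2) (Fin 2) F →ₐ[F] A, f.range = adjoin F {p, q} := by
  have hqp : q * p = 1 - p * q := eq_sub_of_add_eq' hpq
  have hpqp : p * q * p = p := by
    rw [mul_assoc, hqp, mul_sub, mul_one, ← mul_assoc, hp, zero_mul, sub_zero]
  have hqpq : q * p * q = q := by
    rw [hqp, sub_mul, one_mul, mul_assoc, hq, mul_zero, sub_zero]
  let φ : Matrix (Fin 2) (Fin 2) F →ₗ[F] A :=
    { toFun := fun M => M 0 0 • (p * q) + M 0 1 • p + M 1 0 • q + M 1 1 • (q * p)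
      map_add' := fun M N => by simp only [Matrix.add_apply, add_smul]; abel
      map_smul' := fun c M => by simp [smul_smul, smul_add] }
  have φ_apply (M) : φ M = M 0 0 • (p * q) + M 0 1 • p + M 1 0 • q + M 1 1 • (q * p) := rfl
  have φ_one : φ 1 = 1 := by simp [φ_apply, hpq]
  have h1 : p * q * (p * q) = p * q := by rw [← mul_assoc, hpqp]
  have h2 : q * p * (q * p) = q * p := by rw [← mul_assoc, hqpq]
  have h3 : p * q * q = 0 := by rw [mul_assoc, hq, mul_zero]
  have h4 : p * q * (q * p) = 0 := by rw [← mul_assoc, h3, zero_mul]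
  have h5 : p * (p * q) = 0 := by rw [← mul_assoc, hp, zero_mul]
  have h6 : p * (q * p) = p := by rw [← mul_assoc, hpqp]
  have h7 : q * (p * q) = q := by rw [← mul_assoc, hqpq]
  have h8 : q * (q * p) = 0 := by rw [← mul_assoc, hq, zero_mul]
  have h9 : q * p * p = 0 := by rw [mul_assoc, hp, mul_zero]
  have h10 : q * p * (p * q) = 0 := by rw [← mul_assoc, h9, zero_mul]
  let f : Matrix (Fin 2) (Fin 2) F →ₐ[F] A := AlgHom.ofLinearMap φ φ_one fun M N => by
    simp only [φ_apply, Matrix.mul_apply, Fin.sum_univ_two, add_mul, mul_add, smul_mul_smul_comm,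
      hp, hq, hpqp, hqpq, h1, h2, h3, h4, h5, h6, h7, h8, h9, h10, smul_zero, add_smul]
    abel
  refine ⟨f, le_antisymm ?_ (adjoin_le ?_)⟩
  · rintro _ ⟨M, rfl⟩
    have hp' : p ∈ adjoin F {p, q} := subset_adjoin (by simp)
    have hq' : q ∈ adjoin F {p, q} := subset_adjoin (by simp)
    exact add_mem (add_mem (add_mem (Subalgebra.smul_mem _ (mul_mem hp' hq') _)
      (Subalgebra.smul_mem _ hp' _)) (Subalgebra.smul_mem _ hq' _))
      (Subalgebra.smul_mem _ (mul_mem hq' hp') _)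
  · rintro _ (rfl | rfl)
    · exact ⟨!![0, 1; 0, 0], by simp [f, φ_apply]⟩
    · exact ⟨!![0, 0; 1, 0], by simp [f, φ_apply]⟩

lemma range_tensorProduct_lift {F A B C : Type*} [CommSemiring F] [Semiring A] [Algebra F A]
    [Semiring B] [Algebra F B] [Semiring C] [Algebra F C] (f : A →ₐ[F] C) (g : B →ₐ[F] C)
    (h : ∀ x y, Commute (f x) (g y)) :
    (Algebra.TensorProduct.lift f g h).range = f.range ⊔ g.range := by
  refine le_antisymm ?_ (sup_le ?_ ?_)
  · rintro _ ⟨x, rfl⟩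
    induction x using TensorProduct.induction_on with
    | zero => exact (map_zero (Algebra.TensorProduct.lift f g h)).symm ▸ zero_mem _
    | tmul a b =>
      exact mul_mem (le_sup_left (a := f.range) (b := g.range) ⟨a, rfl⟩)
        (le_sup_right (a := f.range) (b := g.range) ⟨b, rfl⟩)
    | add x y hx hy =>
      exact (map_add (Algebra.TensorProduct.lift f g h) x y).symm ▸ add_mem hx hy
  · rintro _ ⟨a, rfl⟩
    exact ⟨a ⊗ₜ 1, by simp⟩
  · rintro _ ⟨b, rfl⟩
    exact ⟨1 ⊗ₜ b, by simp⟩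

/-- Commuting homomorphic images of `M_m(F)` and `M_n(F)` generate an image of `M_{mn}(F)`. -/
lemma exists_matrix_mul_algHom {F A : Type*} [Field F] [Ring A] [Algebra F A] {m n : ℕ}
    (f : Matrix (Fin m) (Fin m) F →ₐ[F] A) (g : Matrix (Fin n) (Fin n) F →ₐ[F] A)
    (h : ∀ x y, Commute (f x) (g y)) :
    ∃ e : Matrix (Fin (m * n)) (Fin (m * n)) F →ₐ[F] A, e.range = f.range ⊔ g.range := by
  let φ := (Matrix.reindexAlgEquiv F F finProdFinEquiv.symm).trans
    (Matrix.kroneckerAlgEquiv (Fin m) (Fin n) F).symm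
  refine ⟨(Algebra.TensorProduct.lift f g h).comp φ.toAlgHom, ?_⟩
  rw [← range_tensorProduct_lift f g h]
  exact SetLike.coe_injective (φ.surjective.range_comp _)

/-- If `M_n(F)` maps to a finite-dimensional algebra, then `n` divides its dimension. -/
lemma dvd_finrank_of_matrix_algHom_s8 {F A : Type*} [Field F] [Ring A] [Algebra F A]
    [FiniteDimensional F A] {n : ℕ} (hn : 0 < n) (g : Matrix (Fin n) (Fin n) F →ₐ[F] A) :
    n ∣ finrank F A := by
  let o : Fin n := ⟨0, hn⟩
  let E (i j : Fin n) : A := g (Matrix.single i j 1)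
  have E_mul (i j k) : E i j * E j k = E i k := by simp [E, ← map_mul]
  have E_mul_ne (i j k l) (h : j ≠ k) : E i j * E k l = 0 := by
    simp [E, ← map_mul, Matrix.single_mul_single_of_ne, h]
  have E_sum : ∑ i, E i i = 1 := by
    simp only [E, ← map_sum, Matrix.sum_single_one, map_one]
  let N : Submodule F A := LinearMap.eqLocus (LinearMap.mulLeft F (E o o)) LinearMap.id
  have mem_N {a} : a ∈ N ↔ E o o * a = a := Iff.rfl
  let e : A ≃ₗ[F] (Fin n → N) :=
    { toFun := fun a i => ⟨E o i * a, by rw [mem_N, ← mul_assoc, E_mul]⟩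
      map_add' := fun a b => by ext; simp [mul_add]
      map_smul' := fun c a => by ext; simp
      invFun := fun x => ∑ i, E i o * (x i : A)
      left_inv := fun a => by
        simp only [← mul_assoc, E_mul]
        rw [← Finset.sum_mul, E_sum, one_mul]
      right_inv := fun x => by
        ext i
        simp only [Finset.mul_sum, ← mul_assoc]
        rw [Finset.sum_eq_single i]
        · rw [E_mul]; exact (x i).2
        · intro j _ hj
          rw [E_mul_ne _ _ _ _ hj.symm, zero_mul]
        · simp }
  rw [e.finrank_eq, finrank_pi_fintype]
  simp

section Clifford

open CliffordAlgebra QuadraticMap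

variable {F V : Type*} [Field F] [AddCommGroup V] [Module F V]

lemma exists_notMem_of_finiteDimensional (hV : ¬ FiniteDimensional F V) (U : Submodule F V)
    [FiniteDimensional F U] : ∃ v, v ∉ U := by
  by_contra! h
  obtain rfl : U = ⊤ := Submodule.eq_top_iff'.2 h
  exact hV Submodule.topEquiv.finiteDimensional

lemma ι_mul_ι_of_polar_eq_zero {Q : QuadraticForm F V} {a b : V} (h : polar Q a b = 0) :
    ι Q a * ι Q b = -(ι Q b * ι Q a) := by
  rw [ι_mul_ι_comm, h, map_zero, zero_sub]

/-- A finite-dimensional subspace `W` that splits off orthogonally, generates a copy of the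
`2ᵏ × 2ᵏ` matrices in the Clifford algebra, and carries a volume element. -/
structure IsSplitSubspace (Q : QuadraticForm F V) (k : ℕ) (W : Submodule F V) : Prop where
  finiteDimensional : FiniteDimensional F W
  exists_proj : ∀ v, ∃ w ∈ W, ∀ u ∈ W, polar Q (v - w) u = 0
  exists_algHom : ∃ f : Matrix (Fin (2 ^ k)) (Fin (2 ^ k)) F →ₐ[F] CliffordAlgebra Q,
    f.range = adjoin F (ι Q '' W)
  exists_volume : ∃ ω ∈ adjoin F (ι Q '' W), ω * ω = 1 ∧
    (∀ w ∈ W, ω * ι Q w = -(ι Q w * ω)) ∧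
    ∀ v, (∀ w ∈ W, polar Q v w = 0) → Commute ω (ι Q v)

namespace IsSplitSubspace

variable {Q : QuadraticForm F V} {k : ℕ} {W : Submodule F V}

variable (Q) in
lemma bot : IsSplitSubspace Q 0 ⊥ where
  finiteDimensional := inferInstance
  exists_proj v := ⟨0, zero_mem _, fun u hu => by simp [(Submodule.mem_bot F).1 hu]⟩
  exists_algHom := by
    let f : Matrix (Fin (2 ^ 0)) (Fin (2 ^ 0)) F →ₐ[F] F :=
      { toFun := fun M => M 0 0
        map_one' := rfl
        map_mul' := fun M N => by simp [Matrix.mul_apply]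
        map_zero' := rfl
        map_add' := fun _ _ => rfl
        commutes' := fun c => by simp [Matrix.algebraMap_matrix_apply] }
    have hf : Function.Surjective f := fun c => ⟨Matrix.of fun _ _ => c, rfl⟩
    refine ⟨(ofId F (CliffordAlgebra Q)).comp f, ?_⟩
    refine (SetLike.coe_injective (hf.range_comp (ofId F (CliffordAlgebra Q))) :
      ((ofId F (CliffordAlgebra Q)).comp f).range = (ofId F (CliffordAlgebra Q)).range).trans
      (le_antisymm ?_ (adjoin_le ?_))
    · rintro _ ⟨c, rfl⟩
      exact Subalgebra.algebraMap_mem _ c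
    · rintro _ ⟨w, hw, rfl⟩
      rw [(Submodule.mem_bot F).1 hw, map_zero]
      exact zero_mem _
  exists_volume := ⟨1, one_mem _, one_mul 1, fun w hw => by simp [(Submodule.mem_bot F).1 hw],
    fun v _ => Commute.one_left _⟩

/-- Adjoining an orthogonal hyperbolic pair to a split subspace. -/
lemma sup_span_pair (hW : IsSplitSubspace Q k W) {p q : V}
    (hpW : ∀ w ∈ W, polar Q p w = 0) (hqW : ∀ w ∈ W, polar Q q w = 0)
    (hp : Q p = 0) (hq : Q q = 0) (hpq : polar Q p q = 1) :
    IsSplitSubspace Q (k + 1) (W ⊔ Submodule.span F {p, q}) := by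
  have mem_iff {u : V} : u ∈ W ⊔ Submodule.span F {p, q} ↔
      ∃ w ∈ W, ∃ a b : F, w + (a • p + b • q) = u := by
    simp [Submodule.mem_sup, Submodule.mem_span_pair]
  have hWle : W ≤ W ⊔ Submodule.span F {p, q} := le_sup_left
  have hpmem : p ∈ W ⊔ Submodule.span F {p, q} :=
    le_sup_right (a := W) (Submodule.subset_span (by simp))
  have hqmem : q ∈ W ⊔ Submodule.span F {p, q} :=
    le_sup_right (a := W) (Submodule.subset_span (by simp))
  have hqp : polar Q q p = 1 := by rw [polar_comm, hpq]
  have hpp : polar Q p p = 0 := by simp [polar_self, hp]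
  have hqq : polar Q q q = 0 := by simp [polar_self, hq]
  obtain ⟨ω, hωW, hωω, hωanti, hωcomm⟩ := hW.exists_volume
  obtain ⟨f, hf⟩ := hW.exists_algHom
  have cp : Commute ω (ι Q p) := hωcomm p hpW
  have cq : Commute ω (ι Q q) := hωcomm q hqW
  have hPP : ι Q p * ι Q p = 0 := by rw [ι_sq_scalar, hp, map_zero]
  have hQQ : ι Q q * ι Q q = 0 := by rw [ι_sq_scalar, hq, map_zero]
  have hPQ : ι Q p * ι Q q + ι Q q * ι Q p = 1 := by rw [ι_mul_ι_add_swap, hpq, map_one]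
  have apW {w} (hw : w ∈ W) : ι Q p * ι Q w = -(ι Q w * ι Q p) :=
    ι_mul_ι_of_polar_eq_zero (hpW w hw)
  have aqW {w} (hw : w ∈ W) : ι Q q * ι Q w = -(ι Q w * ι Q q) :=
    ι_mul_ι_of_polar_eq_zero (hqW w hw)
  have ωmul {a b : CliffordAlgebra Q} (ha : Commute ω a) : ω * a * (ω * b) = a * b := by
    rw [ha.eq, mul_assoc, ← mul_assoc ω, hωω, one_mul]
  obtain ⟨g, hg⟩ := exists_matrix_two_algHom (F := F) (p := ω * ι Q p) (q := ω * ι Q q)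
    (by rw [ωmul cp, hPP]) (by rw [ωmul cq, hQQ]) (by rw [ωmul cp, ωmul cq, hPQ])
  have ωcomm {v w : V} (hw : w ∈ W) (h : ι Q v * ι Q w = -(ι Q w * ι Q v)) :
      Commute (ι Q w) (ω * ι Q v) := by
    change _ = _
    rw [mul_assoc, h, mul_neg, ← mul_assoc, ← mul_assoc, hωanti w hw, neg_mul, neg_neg]
  have hfg : ∀ x y, Commute (f x) (g y) := by
    intro x y
    have hx : f x ∈ adjoin F (ι Q '' W) := hf ▸ ⟨x, rfl⟩
    have hy : g y ∈ adjoin F {ω * ι Q p, ω * ι Q q} := hg ▸ ⟨y, rfl⟩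
    refine commute_of_mem_adjoin_of_forall_mem_commute hy ?_
    rintro _ hb
    refine (commute_of_mem_adjoin_of_forall_mem_commute hx ?_).symm
    rintro _ ⟨w, hw, rfl⟩
    obtain rfl | rfl := hb
    · exact (ωcomm hw (apW hw)).symm
    · exact (ωcomm hw (aqW hw)).symm
  obtain ⟨e, he⟩ := exists_matrix_mul_algHom f g hfg
  have hadj : adjoin F (ι Q '' W) ≤ adjoin F (ι Q '' ↑(W ⊔ Submodule.span F {p, q})) :=
    adjoin_mono (Set.image_mono hWle)
  have hPmem : ι Q p ∈ adjoin F (ι Q '' ↑(W ⊔ Submodule.span F {p, q})) :=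
    subset_adjoin ⟨p, hpmem, rfl⟩
  have hQmem : ι Q q ∈ adjoin F (ι Q '' ↑(W ⊔ Submodule.span F {p, q})) :=
    subset_adjoin ⟨q, hqmem, rfl⟩
  have key : adjoin F (ι Q '' W) ⊔ adjoin F {ω * ι Q p, ω * ι Q q} =
      adjoin F (ι Q '' ↑(W ⊔ Submodule.span F {p, q})) := by
    refine le_antisymm (sup_le hadj (adjoin_le ?_)) (adjoin_le ?_)
    · rintro _ (rfl | rfl)
      · exact mul_mem (hadj hωW) hPmem
      · exact mul_mem (hadj hωW) hQmem
    · rintro _ ⟨u, hu, rfl⟩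
      obtain ⟨w, hw, a, b, rfl⟩ := mem_iff.1 hu
      have hω : ω ∈ adjoin F (ι Q '' W) ⊔ adjoin F {ω * ι Q p, ω * ι Q q} :=
        le_sup_left (a := adjoin F (ι Q '' W)) hωW
      have hmem {v : V} (hv : ω * ι Q v ∈ adjoin F {ω * ι Q p, ω * ι Q q}) :
          ι Q v ∈ adjoin F (ι Q '' W) ⊔ adjoin F {ω * ι Q p, ω * ι Q q} := by
        have := mul_mem hω (le_sup_right (a := adjoin F (ι Q '' W)) hv)
        rwa [← mul_assoc, hωω, one_mul] at this
      simp only [map_add, map_smul]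
      exact add_mem (le_sup_left (a := adjoin F (ι Q '' W)) (subset_adjoin ⟨w, hw, rfl⟩))
        (add_mem (Subalgebra.smul_mem _ (hmem (subset_adjoin (by simp))) _)
          (Subalgebra.smul_mem _ (hmem (subset_adjoin (by simp))) _))
  refine ⟨?_, fun v => ?_, ?_, ω * (ι Q p * ι Q q - ι Q q * ι Q p), ?_, ?_, ?_, ?_⟩
  · have := hW.finiteDimensional
    have := FiniteDimensional.span_of_finite F (Set.toFinite {p, q})
    infer_instance
  · obtain ⟨w, hw, h⟩ := hW.exists_proj v
    refine ⟨w + (polar Q v q • p + polar Q v p • q), mem_iff.2 ⟨w, hw, _, _, rfl⟩, ?_⟩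
    intro u hu
    obtain ⟨w', hw', a, b, rfl⟩ := mem_iff.1 hu
    have h' := h w' hw'
    rw [polar_sub_left] at h'
    simp only [polar_sub_left, polar_add_left, polar_smul_left, polar_add_right,
      polar_smul_right, smul_eq_mul, hpp, hqq, hpq, hqp, hpW w' hw', hqW w' hw',
      polar_comm Q w p, polar_comm Q w q, hpW w hw, hqW w hw]
    linear_combination h'
  · rw [pow_succ, ← key, ← hf, ← hg]
    exact ⟨e, he⟩
  · exact mul_mem (hadj hωW) (sub_mem (mul_mem hPmem hQmem) (mul_mem hQmem hPmem))
  · rw [ωmul ((cp.mul_right cq).sub_right (cq.mul_right cp)), ← hPQ]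
    have h1 : ι Q p * ι Q q * (ι Q q * ι Q p) = 0 := by
      rw [mul_assoc, ← mul_assoc (ι Q q), hQQ, zero_mul, mul_zero]
    have h2 : ι Q q * ι Q p * (ι Q p * ι Q q) = 0 := by
      rw [mul_assoc, ← mul_assoc (ι Q p), hPP, zero_mul, mul_zero]
    calc _ = (ι Q p * ι Q q + ι Q q * ι Q p) * (ι Q p * ι Q q + ι Q q * ι Q p) := by
          simp only [sub_mul, mul_sub, add_mul, mul_add, h1, h2]; abel
      _ = _ := by rw [hPQ, one_mul]
  · intro u hu
    obtain ⟨w, hw, a, b, rfl⟩ := mem_iff.1 hu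
    have hw' : ω * (ι Q p * ι Q q - ι Q q * ι Q p) * ι Q w =
        -(ι Q w * (ω * (ι Q p * ι Q q - ι Q q * ι Q p))) := by
      have hc : Commute (ι Q p * ι Q q - ι Q q * ι Q p) (ι Q w) := by
        change _ = _
        have h1 : ι Q p * ι Q q * ι Q w = ι Q w * (ι Q p * ι Q q) := by
          rw [mul_assoc, aqW hw, mul_neg, ← mul_assoc, apW hw, neg_mul, neg_neg, mul_assoc]
        have h2 : ι Q q * ι Q p * ι Q w = ι Q w * (ι Q q * ι Q p) := by
          rw [mul_assoc, apW hw, mul_neg, ← mul_assoc, aqW hw, neg_mul, neg_neg, mul_assoc]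
        rw [sub_mul, mul_sub, h1, h2]
      rw [mul_assoc, hc.eq, ← mul_assoc, hωanti w hw, neg_mul, mul_assoc]
    have hp' : ω * (ι Q p * ι Q q - ι Q q * ι Q p) * ι Q p =
        -(ι Q p * (ω * (ι Q p * ι Q q - ι Q q * ι Q p))) := by
      rw [← mul_assoc (ι Q p), ← cp.eq, mul_assoc, mul_assoc, ← mul_neg]
      congr 1
      simp only [sub_mul, mul_sub, mul_assoc, hPP, mul_zero, sub_zero]
      rw [← mul_assoc (ι Q p) (ι Q p), hPP, zero_mul, zero_sub, neg_neg]
    have hq' : ω * (ι Q p * ι Q q - ι Q q * ι Q p) * ι Q q =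
        -(ι Q q * (ω * (ι Q p * ι Q q - ι Q q * ι Q p))) := by
      rw [← mul_assoc (ι Q q), ← cq.eq, mul_assoc, mul_assoc, ← mul_neg]
      congr 1
      simp only [sub_mul, mul_sub, mul_assoc, hQQ, mul_zero, zero_sub]
      rw [← mul_assoc (ι Q q) (ι Q q), hQQ, zero_mul, sub_zero]
    simp only [map_add, map_smul, mul_add, add_mul, mul_smul_comm, smul_mul_assoc, hw', hp', hq',
      neg_add, smul_neg]
  · intro v hv
    have hcω : Commute ω (ι Q v) := hωcomm v fun w hw => hv w (hWle hw)
    have h1 := ι_mul_ι_of_polar_eq_zero (hv p hpmem)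
    have h2 := ι_mul_ι_of_polar_eq_zero (hv q hqmem)
    have h3 : Commute (ι Q p * ι Q q) (ι Q v) := by
      change _ = _
      rw [← mul_assoc, h1, neg_mul, mul_assoc, mul_assoc, h2, mul_neg, neg_neg]
    have h4 : Commute (ι Q q * ι Q p) (ι Q v) := by
      change _ = _
      rw [← mul_assoc, h2, neg_mul, mul_assoc, mul_assoc, h1, mul_neg, neg_neg]
    exact hcω.mul_left (h3.sub_left h4)

/-- The orthogonal complement of a finite-dimensional orthogonal summand of an infinite-dimensional
nondegenerate quadratic space is not totally singular. -/
lemma exists_orthogonal_ne_zero (hV : ¬ FiniteDimensional F V)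
    (hQ : LinearMap.BilinForm.Nondegenerate (polarBilin Q)) (U : Submodule F V)
    [FiniteDimensional F U] (hU : ∀ v, ∃ w ∈ U, ∀ u ∈ U, polar Q (v - w) u = 0) :
    ∃ u, (∀ w ∈ U, polar Q u w = 0) ∧ Q u ≠ 0 := by
  obtain ⟨x, hx⟩ := exists_notMem_of_finiteDimensional hV U
  obtain ⟨w, hw, hxw⟩ := hU x
  have hne : x - w ≠ 0 := fun h => hx (sub_eq_zero.1 h ▸ hw)
  obtain ⟨y, hy⟩ : ∃ y, polar Q (x - w) y ≠ 0 := by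
    by_contra! h
    exact hne (hQ.1 _ h)
  obtain ⟨z, hz, hyz⟩ := hU y
  have hpol : polar Q (x - w) (y - z) ≠ 0 := by rwa [polar_sub_right, hxw z hz, sub_zero]
  by_contra! h
  refine hpol ?_
  rw [polar, h _ hxw, h _ hyz, h _ fun u hu => by rw [polar_add_left, hxw u hu, hyz u hu, add_zero]]
  simp

/-- A nonzero vector orthogonal to a split subspace lies in an orthogonal hyperbolic plane. -/
lemma exists_hyperbolic_pair [IsAlgClosed F] (h2 : (2 : F) ≠ 0) (hV : ¬ FiniteDimensional F V)
    (hQ : LinearMap.BilinForm.Nondegenerate (polarBilin Q)) (hW : IsSplitSubspace Q k W) {v : V}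
    (hv : ∀ w ∈ W, polar Q v w = 0) (hv0 : v ≠ 0) :
    ∃ p q, (∀ w ∈ W, polar Q p w = 0) ∧ (∀ w ∈ W, polar Q q w = 0) ∧ Q p = 0 ∧ Q q = 0 ∧
      polar Q p q = 1 ∧ v ∈ Submodule.span F {p, q} := by
  by_cases hQv : Q v = 0
  · obtain ⟨y, hy⟩ : ∃ y, polar Q v y ≠ 0 := by
      by_contra! h
      exact hv0 (hQ.1 _ h)
    obtain ⟨z, hz, hyz⟩ := hW.exists_proj y
    have hvu : polar Q v (y - z) ≠ 0 := by rwa [polar_sub_right, hv z hz, sub_zero]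
    set u := y - z
    set c := polar Q v u
    refine ⟨v, c⁻¹ • u + (-(c⁻¹ * c⁻¹ * Q u)) • v, hv, fun w hw => ?_, hQv, ?_, ?_,
      Submodule.subset_span (by simp)⟩
    · rw [polar_add_left, polar_smul_left, polar_smul_left, hyz w hw, hv w hw]
      simp
    · rw [QuadraticMap.map_add Q, QuadraticMap.map_smul, QuadraticMap.map_smul, polar_smul_left,
        polar_smul_right, polar_comm, hQv]
      simp only [smul_eq_mul]
      change c⁻¹ * c⁻¹ * Q u + _ + c⁻¹ * (_ * c) = 0
      field_simp
      ring
    · rw [polar_add_right, polar_smul_right, polar_smul_right, polar_self, hQv]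
      simp [c, hvu]
  · have hU : ∀ y, ∃ w ∈ W ⊔ Submodule.span F {v}, ∀ u ∈ W ⊔ Submodule.span F {v},
        polar Q (y - w) u = 0 := by
      intro y
      obtain ⟨w, hw, h⟩ := hW.exists_proj y
      refine ⟨w + ((2 * Q v)⁻¹ * polar Q y v) • v, Submodule.add_mem_sup hw
        (Submodule.smul_mem _ _ (Submodule.mem_span_singleton_self v)), fun u hu => ?_⟩
      obtain ⟨w', hw', _, hs, rfl⟩ := Submodule.mem_sup.1 hu
      obtain ⟨a, rfl⟩ := Submodule.mem_span_singleton.1 hs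
      have h' := h w' hw'
      rw [polar_sub_left] at h'
      simp only [polar_sub_left, polar_add_left, polar_smul_left, polar_add_right,
        polar_smul_right, smul_eq_mul, polar_self, hv w' hw', polar_comm Q w v, hv w hw,
        nsmul_eq_mul, Nat.cast_ofNat]
      field_simp
      linear_combination (2 * Q v) * h'
    have := hW.finiteDimensional
    obtain ⟨u, hu, hQu⟩ := exists_orthogonal_ne_zero hV hQ _ hU
    have huW : ∀ w ∈ W, polar Q u w = 0 := fun w hw => hu w (le_sup_left (a := W) hw)
    have huv : polar Q u v = 0 :=
      hu v (le_sup_right (a := W) (Submodule.mem_span_singleton_self v))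
    have hvu : polar Q v u = 0 := by rw [polar_comm, huv]
    obtain ⟨s, hs⟩ := IsAlgClosed.exists_pow_nat_eq (-Q v / Q u) two_pos
    have hs' : s * s * Q u = -Q v := by rw [← pow_two, hs]; field_simp
    have h4 : (4 : F) ≠ 0 := by
      have : (4 : F) = 2 * 2 := by norm_num
      rw [this]
      exact mul_ne_zero h2 h2
    refine ⟨v + s • u, (4 * Q v)⁻¹ • (v + (-s) • u), fun w hw => ?_, fun w hw => ?_, ?_, ?_, ?_, ?_⟩
    · simp [polar_add_left, polar_smul_left, hv w hw, huW w hw]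
    · simp [polar_add_left, polar_smul_left, hv w hw, huW w hw]
    · simp [QuadraticMap.map_add Q, QuadraticMap.map_smul, polar_smul_right, hvu, hs']
    · simp [QuadraticMap.map_add Q, QuadraticMap.map_smul, polar_smul_right, hvu, hs']
    · simp only [polar_add_left, polar_smul_left, polar_add_right, polar_smul_right, smul_eq_mul,
        polar_self, hvu, huv, nsmul_eq_mul, Nat.cast_ofNat]
      field_simp
      linear_combination (-2) * hs'
    · refine Submodule.mem_span_pair.2 ⟨2⁻¹, 2⁻¹ * (4 * Q v), ?_⟩
      rw [smul_smul, mul_assoc, mul_inv_cancel₀ (mul_ne_zero h4 hQv), mul_one, ← smul_add,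
        neg_smul, add_add_add_comm, add_neg_cancel, add_zero, ← two_smul F v, smul_smul,
        inv_mul_cancel₀ h2, one_smul]

lemma exists_succ_of_notMem [IsAlgClosed F] (h2 : (2 : F) ≠ 0) (hV : ¬ FiniteDimensional F V)
    (hQ : LinearMap.BilinForm.Nondegenerate (polarBilin Q)) (hW : IsSplitSubspace Q k W) {v : V}
    (hv : v ∉ W) : ∃ W', IsSplitSubspace Q (k + 1) W' ∧ W ≤ W' ∧ v ∈ W' := by
  obtain ⟨w, hw, hvw⟩ := hW.exists_proj v
  obtain ⟨p, q, hpW, hqW, hp, hq, hpq, hmem⟩ := exists_hyperbolic_pair h2 hV hQ hW hvw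
    fun h => hv (sub_eq_zero.1 h ▸ hw)
  exact ⟨_, hW.sup_span_pair hpW hqW hp hq hpq, le_sup_left,
    by simpa using Submodule.add_mem_sup hw hmem⟩

lemma exists_of_nat [IsAlgClosed F] (h2 : (2 : F) ≠ 0) (hV : ¬ FiniteDimensional F V)
    (hQ : LinearMap.BilinForm.Nondegenerate (polarBilin Q)) (k : ℕ) :
    ∃ W, IsSplitSubspace Q k W := by
  induction k with
  | zero => exact ⟨⊥, bot Q⟩
  | succ k ih =>
    obtain ⟨W, hW⟩ := ih
    have := hW.finiteDimensional
    obtain ⟨v, hv⟩ := exists_notMem_of_finiteDimensional hV W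
    obtain ⟨W', hW', -⟩ := exists_succ_of_notMem h2 hV hQ hW hv
    exact ⟨W', hW'⟩

lemma exists_mem_adjoin [IsAlgClosed F] (h2 : (2 : F) ≠ 0) (hV : ¬ FiniteDimensional F V)
    (hQ : LinearMap.BilinForm.Nondegenerate (polarBilin Q)) (a : CliffordAlgebra Q) :
    ∀ {k : ℕ} {W : Submodule F V}, IsSplitSubspace Q k W →
      ∃ k' W', IsSplitSubspace Q k' W' ∧ W ≤ W' ∧ a ∈ adjoin F (ι Q '' W') := by
  induction a using CliffordAlgebra.induction with
  | algebraMap r => exact fun hW => ⟨_, _, hW, le_rfl, Subalgebra.algebraMap_mem _ r⟩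
  | ι v =>
    intro k W hW
    by_cases hv : v ∈ W
    · exact ⟨_, _, hW, le_rfl, subset_adjoin ⟨v, hv, rfl⟩⟩
    · obtain ⟨W', hW', hle, hmem⟩ := exists_succ_of_notMem h2 hV hQ hW hv
      exact ⟨_, _, hW', hle, subset_adjoin ⟨v, hmem, rfl⟩⟩
  | mul a b ha hb =>
    intro k W hW
    obtain ⟨_, W₁, hW₁, hle₁, ha₁⟩ := ha hW
    obtain ⟨_, W₂, hW₂, hle₂, hb₂⟩ := hb hW₁
    exact ⟨_, W₂, hW₂, hle₁.trans hle₂, mul_mem (adjoin_mono (Set.image_mono hle₂) ha₁) hb₂⟩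
  | add a b ha hb =>
    intro k W hW
    obtain ⟨_, W₁, hW₁, hle₁, ha₁⟩ := ha hW
    obtain ⟨_, W₂, hW₂, hle₂, hb₂⟩ := hb hW₁
    exact ⟨_, W₂, hW₂, hle₁.trans hle₂, add_mem (adjoin_mono (Set.image_mono hle₂) ha₁) hb₂⟩

lemma exists_finset_subset_adjoin [IsAlgClosed F] (h2 : (2 : F) ≠ 0)
    (hV : ¬ FiniteDimensional F V) (hQ : LinearMap.BilinForm.Nondegenerate (polarBilin Q))
    (s : Finset (CliffordAlgebra Q)) :
    ∃ k W, IsSplitSubspace Q k W ∧ (s : Set (CliffordAlgebra Q)) ⊆ adjoin F (ι Q '' W) := by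
  classical
  induction s using Finset.induction_on with
  | empty => exact ⟨0, ⊥, bot Q, by simp⟩
  | insert a s _ ih =>
    obtain ⟨k, W, hW, hs⟩ := ih
    obtain ⟨k', W', hW', hle, ha⟩ := exists_mem_adjoin h2 hV hQ a hW
    refine ⟨k', W', hW', ?_⟩
    rw [Finset.coe_insert]
    exact Set.insert_subset ha (hs.trans (adjoin_mono (Set.image_mono hle)))

lemma nonempty_algEquiv (h2 : (2 : F) ≠ 0) (hW : IsSplitSubspace Q k W) :
    Nonempty (adjoin F (ι Q '' W) ≃ₐ[F] Matrix (Fin (2 ^ k)) (Fin (2 ^ k)) F) := by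
  have := invertibleOfNonzero h2
  obtain ⟨f, hf⟩ := hW.exists_algHom
  have := Fin.pos_iff_nonempty.1 (Nat.two_pow_pos k)
  have hinj : Function.Injective f := f.toRingHom.injective
  exact hf ▸ ⟨(AlgEquiv.ofInjective f hinj).symm⟩

end IsSplitSubspace

end Clifford

/-- If a subalgebra isomorphic to `M_n(F)` is contained in one isomorphic to `M_{2ᵏ}(F)`, then `n` is
a power of two. -/
lemma exists_eq_two_pow_of_le {F A : Type*} [Field F] [Ring A] [Algebra F A] {n k : ℕ}
    (hn : 0 < n) {S T : Subalgebra F A} (hST : S ≤ T)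
    (e : S ≃ₐ[F] Matrix (Fin n) (Fin n) F)
    (e' : T ≃ₐ[F] Matrix (Fin (2 ^ k)) (Fin (2 ^ k)) F) : ∃ m : ℕ, n = 2 ^ m := by
  have h := dvd_finrank_of_matrix_algHom_s8 hn
    ((e'.toAlgHom.comp (Subalgebra.inclusion hST)).comp e.symm.toAlgHom)
  rw [finrank_matrix, finrank_self, mul_one, Fintype.card_fin, ← pow_add] at h
  obtain ⟨m, -, hm⟩ := (Nat.dvd_prime_pow Nat.prime_two).1 h
  exact ⟨m, hm⟩

theorem stmt_8 (F : Type*) [Field F] [IsAlgClosed F] (hchar : ringChar F ≠ 2)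
    (V : Type*) [AddCommGroup V] [Module F V] (hV : ¬ FiniteDimensional F V)
    (Q : QuadraticForm F V)
    (hQ : LinearMap.BilinForm.Nondegenerate (QuadraticMap.polarBilin Q)) :
    IsLocallyMatrixAlgebra F (CliffordAlgebra Q) ∧
      matrixDegreeSet F (CliffordAlgebra Q) = {n | ∃ k : ℕ, n = 2 ^ k} := by
  have h2 : (2 : F) ≠ 0 := Ring.two_ne_zero hchar
  refine ⟨fun s => ?_, Set.ext fun n => ⟨?_, ?_⟩⟩
  · obtain ⟨k, W, hW, hs⟩ := IsSplitSubspace.exists_finset_subset_adjoin h2 hV hQ s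
    exact ⟨2 ^ k, _, Nat.two_pow_pos k, hs, hW.nonempty_algEquiv h2⟩
  · rintro ⟨hn, S, ⟨e⟩⟩
    have : FiniteDimensional F S := e.symm.toLinearEquiv.finiteDimensional
    obtain ⟨s, hs⟩ := (Submodule.fg_iff_finiteDimensional (Subalgebra.toSubmodule S)).2 this
    obtain ⟨k, W, hW, hsW⟩ := IsSplitSubspace.exists_finset_subset_adjoin h2 hV hQ s
    obtain ⟨e'⟩ := hW.nonempty_algEquiv h2
    have hle : Subalgebra.toSubmodule S ≤
        Subalgebra.toSubmodule (adjoin F (CliffordAlgebra.ι Q '' W)) := by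
      rw [← hs]
      exact Submodule.span_le.2 hsW
    exact exists_eq_two_pow_of_le hn hle e e'
  · rintro ⟨k, rfl⟩
    obtain ⟨W, hW⟩ := IsSplitSubspace.exists_of_nat h2 hV hQ k
    exact ⟨Nat.two_pow_pos k, _, hW.nonempty_algEquiv h2⟩
end

section
/- Let V be a complex vector space with a quadratic form f, and let Cl(V,f) be its Clifford algebra with canonical map ι : V → Cl(V,f). Let V = V₀ ⊇ V₁ ⊇ V₂ ⊇ … be a descending chain of subspaces such that dim_ℂ(V / V_i) is finite for every i ≥ 0 and ⋂_{i ≥ 0} V_i = (0). Then ⋂_{i ≥ 0} Cl(V_i) = ℂ·1, where Cl(V_i) denotes the unital subalgebra of Cl(V,f) generated by ι(V_i); that is, the infimum over i of the subalgebras Algebra.adjoin ℂ (ι '' V_i) is the bottom subalgebra ℂ·1. -/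
theorem Algebra.adjoin_induction_left {R A : Type*} [CommSemiring R] [Semiring A] [Algebra R A]
    {s : Set A} {p : (x : A) → x ∈ Algebra.adjoin R s → Prop}
    (one : p 1 (one_mem _))
    (smul : ∀ (r : R) x hx, p x hx → p (r • x) (Subalgebra.smul_mem _ hx r))
    (add : ∀ x y hx hy, p x hx → p y hy → p (x + y) (add_mem hx hy))
    (mul_left : ∀ x (hx : x ∈ s) y hy, p y hy → p (x * y) (mul_mem (subset_adjoin hx) hy))
    {x : A} (hx : x ∈ Algebra.adjoin R s) : p x hx := by
  suffices h : ∀ y hy, p y hy → p (x * y) (mul_mem hx hy) by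
    simpa only [mul_one] using h 1 (one_mem _) one
  induction hx using Algebra.adjoin_induction with
  | mem x hx => exact mul_left x hx
  | algebraMap r =>
    intro y hy hpy
    simpa only [Algebra.smul_def] using smul r y hy hpy
  | add x x' hx hx' ihx ihx' =>
    intro y hy hpy
    simpa only [add_mul] using add _ _ _ _ (ihx y hy hpy) (ihx' y hy hpy)
  | mul x x' hx hx' ihx ihx' =>
    intro y hy hpy
    simpa only [mul_assoc] using ihx _ _ (ihx' y hy hpy)

namespace CliffordAlgebra

open Module

section

variable {R M : Type*} [CommRing R] [AddCommGroup M] [Module R M] {Q : QuadraticForm R M}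

theorem contractLeft_eq_zero_of_mem_adjoin {d : Dual R M} {W : Submodule R M}
    (hd : W ≤ LinearMap.ker d) {x : CliffordAlgebra Q}
    (hx : x ∈ Algebra.adjoin R (ι Q '' (W : Set M))) : contractLeft d x = 0 := by
  induction hx using Algebra.adjoin_induction_left with
  | one => exact contractLeft_one Q d
  | smul r y _ hy => rw [map_smul, hy, smul_zero]
  | add y z _ _ hy hz => rw [map_add, hy, hz, add_zero]
  | mul_left y hy z _ hz =>
    obtain ⟨w, hw, rfl⟩ := hy
    rw [contractLeft_ι_mul, hz, LinearMap.mem_ker.mp (hd hw), zero_smul, mul_zero, sub_zero]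

theorem exists_eq_add_ι_mul_of_mem_adjoin {U U' : Submodule R M} {u : M}
    (hU : U ≤ U' ⊔ R ∙ u) {x : CliffordAlgebra Q}
    (hx : x ∈ Algebra.adjoin R (ι Q '' (U : Set M))) :
    ∃ a ∈ Algebra.adjoin R (ι Q '' (U' : Set M)),
      ∃ b ∈ Algebra.adjoin R (ι Q '' (U' : Set M)), x = a + ι Q u * b := by
  induction hx using Algebra.adjoin_induction_left with
  | one => exact ⟨1, one_mem _, 0, zero_mem _, by simp⟩
  | smul r y _ hy =>
    obtain ⟨a, ha, b, hb, rfl⟩ := hy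
    exact ⟨r • a, Subalgebra.smul_mem _ ha r, r • b, Subalgebra.smul_mem _ hb r, by
      rw [smul_add, mul_smul_comm]⟩
  | add y z _ _ hy hz =>
    obtain ⟨a, ha, b, hb, rfl⟩ := hy
    obtain ⟨a', ha', b', hb', rfl⟩ := hz
    exact ⟨_, add_mem ha ha', _, add_mem hb hb', by rw [mul_add]; abel⟩
  | mul_left y hy z _ hz =>
    obtain ⟨w, hw, rfl⟩ := hy
    obtain ⟨a, ha, b, hb, rfl⟩ := hz
    obtain ⟨v, hv, s, hs, rfl⟩ := Submodule.mem_sup.mp (hU hw)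
    obtain ⟨c, rfl⟩ := Submodule.mem_span_singleton.mp hs
    have hv' : ι Q v ∈ Algebra.adjoin R (ι Q '' (U' : Set M)) :=
      Algebra.subset_adjoin ⟨v, hv, rfl⟩
    refine ⟨ι Q v * a + QuadraticMap.polar Q v u • b + (c * Q u) • b,
      add_mem (add_mem (mul_mem hv' ha) (Subalgebra.smul_mem _ hb _)) (Subalgebra.smul_mem _ hb _),
      c • a - ι Q v * b, sub_mem (Subalgebra.smul_mem _ ha _) (mul_mem hv' hb), ?_⟩
    have hvu : ι Q v * (ι Q u * b) = QuadraticMap.polar Q v u • b - ι Q u * (ι Q v * b) := by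
      rw [← mul_assoc, ι_mul_ι_comm, sub_mul, mul_assoc, Algebra.smul_def]
    have huu : ι Q u * (ι Q u * b) = Q u • b := by
      rw [← mul_assoc, ι_sq_scalar, Algebra.smul_def]
    simp only [map_add, map_smul, add_mul, mul_add, mul_sub, smul_mul_assoc, mul_smul_comm, hvu,
      huu, mul_smul]
    abel

theorem mem_adjoin_of_contractLeft_eq_zero {d : Dual R M} {U U' : Submodule R M} {u : M}
    (hd : U' ≤ LinearMap.ker d) (hu : d u = 1) (hU : U ≤ U' ⊔ R ∙ u) {x : CliffordAlgebra Q}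
    (hx : x ∈ Algebra.adjoin R (ι Q '' (U : Set M))) (hdx : contractLeft d x = 0) :
    x ∈ Algebra.adjoin R (ι Q '' (U' : Set M)) := by
  obtain ⟨a, ha, b, hb, rfl⟩ := exists_eq_add_ι_mul_of_mem_adjoin hU hx
  rw [map_add, contractLeft_ι_mul, contractLeft_eq_zero_of_mem_adjoin hd ha,
    contractLeft_eq_zero_of_mem_adjoin hd hb, hu, one_smul, mul_zero, sub_zero, zero_add] at hdx
  rwa [hdx, mul_zero, add_zero]

theorem exists_fg_mem_adjoin (x : CliffordAlgebra Q) :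
    ∃ U : Submodule R M, U.FG ∧ x ∈ Algebra.adjoin R (ι Q '' (U : Set M)) := by
  have mono {U U' : Submodule R M} (h : U ≤ U') :
      Algebra.adjoin R (ι Q '' (U : Set M)) ≤ Algebra.adjoin R (ι Q '' (U' : Set M)) :=
    Algebra.adjoin_mono (Set.image_mono h)
  induction x using CliffordAlgebra.induction with
  | algebraMap r => exact ⟨⊥, Submodule.fg_bot, Subalgebra.algebraMap_mem _ r⟩
  | ι v =>
    exact ⟨R ∙ v, Submodule.fg_span_singleton v,
      Algebra.subset_adjoin ⟨v, Submodule.mem_span_singleton_self v, rfl⟩⟩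
  | mul x y hx hy =>
    obtain ⟨U, hU, hx⟩ := hx
    obtain ⟨U', hU', hy⟩ := hy
    exact ⟨U ⊔ U', hU.sup hU', mul_mem (mono le_sup_left hx) (mono le_sup_right hy)⟩
  | add x y hx hy =>
    obtain ⟨U, hU, hx⟩ := hx
    obtain ⟨U', hU', hy⟩ := hy
    exact ⟨U ⊔ U', hU.sup hU', add_mem (mono le_sup_left hx) (mono le_sup_right hy)⟩

end

section

variable {K V : Type*} [Field K] [AddCommGroup V] [Module K V] {Q : QuadraticForm K V}

theorem mem_bot_of_mem_adjoin_of_disjoint {U W : Submodule K V} [FiniteDimensional K U]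
    (hUW : Disjoint U W) {x : CliffordAlgebra Q}
    (hxU : x ∈ Algebra.adjoin K (ι Q '' (U : Set V)))
    (hxW : x ∈ Algebra.adjoin K (ι Q '' (W : Set V))) :
    x ∈ (⊥ : Subalgebra K (CliffordAlgebra Q)) := by
  induction hn : finrank K U using Nat.strong_induction_on generalizing U with
  | _ n ih =>
    subst hn
    rcases eq_or_ne U ⊥ with rfl | hU
    · rw [← Algebra.adjoin_singleton_zero]
      simpa using hxU
    obtain ⟨u, huU, hu0⟩ := Submodule.exists_mem_ne_zero_of_ne_bot hU
    have huW : u ∉ W := fun h => hu0 (Submodule.disjoint_def.mp hUW u huU h)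
    obtain ⟨g, hgu, hgW⟩ := Submodule.exists_le_ker_of_notMem huW
    obtain ⟨d, hdu, hdW⟩ : ∃ d : Dual K V, d u = 1 ∧ W ≤ LinearMap.ker d :=
      ⟨(g u)⁻¹ • g, by simp [hgu], fun w hw => by simp [LinearMap.mem_ker.mp (hgW hw)]⟩
    have hlt : U ⊓ LinearMap.ker d < U :=
      inf_lt_left.mpr fun h => one_ne_zero (hdu.symm.trans (LinearMap.mem_ker.mp (h huU)))
    have hle : U ≤ (U ⊓ LinearMap.ker d) ⊔ K ∙ u := fun v hv =>
      Submodule.mem_sup.mpr ⟨v - d v • u,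
        ⟨sub_mem hv (U.smul_mem _ huU), by simp [hdu]⟩, d v • u,
        Submodule.smul_mem _ _ (Submodule.mem_span_singleton_self u), sub_add_cancel _ _⟩
    have : FiniteDimensional K (U ⊓ LinearMap.ker d : Submodule K V) :=
      Submodule.finiteDimensional_of_le inf_le_left
    exact ih _ (Submodule.finrank_lt_finrank_of_lt hlt) (hUW.mono_left inf_le_left)
      (mem_adjoin_of_contractLeft_eq_zero inf_le_right hdu hle hxU
        (contractLeft_eq_zero_of_mem_adjoin hdW hxW)) rfl

end

end CliffordAlgebra

theorem Submodule.exists_disjoint_of_antitone_of_iInf_eq_bot {K V : Type*} [Field K]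
    [AddCommGroup V] [Module K V] {W : ℕ → Submodule K V} (hW : Antitone W) (h : ⨅ i, W i = ⊥)
    (U : Submodule K V) [FiniteDimensional K U] : ∃ i, Disjoint U (W i) := by
  obtain ⟨n, hn⟩ := IsArtinian.monotone_stabilizes (R := K) (M := U)
    ⟨fun i => OrderDual.toDual ((W i).comap U.subtype), fun _ _ hij => Submodule.comap_mono (hW hij)⟩
  refine ⟨n, Submodule.disjoint_def.mpr fun x hxU hxn => ?_⟩
  rw [← Submodule.mem_bot K, ← h, Submodule.mem_iInf]
  intro i
  rcases le_total n i with hni | hin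
  · have hx : (⟨x, hxU⟩ : U) ∈ (W n).comap U.subtype := hxn
    rw [show (W n).comap U.subtype = (W i).comap U.subtype from hn i hni] at hx
    exact hx
  · exact hW hin hxn

theorem stmt_14 (V : Type*) [AddCommGroup V] [Module ℂ V] (f : QuadraticForm ℂ V)
    (W : ℕ → Submodule ℂ V) (hW0 : W 0 = ⊤) (hdesc : ∀ i, W (i + 1) ≤ W i)
    (hfin : ∀ i, FiniteDimensional ℂ (V ⧸ W i)) (hinter : (⨅ i, W i) = ⊥) :
    (⨅ i, Algebra.adjoin ℂ (CliffordAlgebra.ι f '' (W i : Set V))) = ⊥ := by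
  refine eq_bot_iff.mpr fun x hx => ?_
  obtain ⟨U, hU, hxU⟩ := CliffordAlgebra.exists_fg_mem_adjoin x
  have : FiniteDimensional ℂ U := Module.Finite.iff_fg.mpr hU
  obtain ⟨i, hi⟩ := Submodule.exists_disjoint_of_antitone_of_iInf_eq_bot
    (antitone_nat_of_succ_le hdesc) hinter U
  exact CliffordAlgebra.mem_bot_of_mem_adjoin_of_disjoint hi hxU (Algebra.mem_iInf.mp hx i)
end
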